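/- For every n ≥ 3, the minimum of ‖δc‖ / ‖c‖_csy over all (n−3)-cochains c of the simplex on n vertices with ℤ/2 coefficients which are not coboundaries equals 2. -/

import Mathlib

open scoped Classical

/-- The norm of a `k`-cochain of the simplex on `n` vertices (with `ℤ/2` coefficients),
viewed as a function on finsets: the number of `(k+1)`-element subsets on which it is
nonzero. -/
noncomputable def cochainNorm (n k : ℕ) (c : Finset (Fin n) → ZMod 2) : ℕ :=
  ((Finset.powersetCard (k + 1) (Finset.univ : Finset (Fin n))).filter fun s => c s ≠ 0).card

/-- `delta n j c B = ∑_{A ⊆ B, |A| = j} c A`.  The coboundary of a `k`-cochain `c`,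
evaluated on `(k+2)`-element subsets, is `delta n (k+1) c`. -/
def delta (n : ℕ) (j : ℕ) (c : Finset (Fin n) → ZMod 2) : Finset (Fin n) → ZMod 2 :=
  fun B => ∑ A ∈ Finset.powersetCard j B, c A

/-- The cosystolic norm of a `k`-cochain `c`: the minimum of `‖c + δf‖` over
`(k-1)`-cochains `f` (where `δf`, on `(k+1)`-element subsets, is `delta n k f`). -/
noncomputable def cosysNormK (n k : ℕ) (c : Finset (Fin n) → ZMod 2) : ℕ :=
  sInf {m | ∃ f : Finset (Fin n) → ZMod 2,
    m = cochainNorm n k (fun s => c s + delta n k f s)}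

lemma delta_eq_sum_erase {n j : ℕ} (c : Finset (Fin n) → ZMod 2) {B : Finset (Fin n)}
    (hB : B.card = j + 1) : delta n j c B = ∑ a ∈ B, c (B.erase a) := by
  unfold delta
  symm
  refine Finset.sum_bij (fun a _ => B.erase a) ?_ ?_ ?_ ?_
  · intro a ha
    rw [Finset.mem_powersetCard, Finset.card_erase_of_mem ha, hB]
    exact ⟨Finset.erase_subset _ _, rfl⟩
  · intro a ha b hb h
    exact (Finset.erase_inj B ha).1 h
  · intro A hA
    rw [Finset.mem_powersetCard] at hA
    have h1 : (B \ A).card = 1 := by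
      rw [Finset.card_sdiff_of_subset hA.1]
      omega
    obtain ⟨a, ha⟩ := Finset.card_eq_one.1 h1
    have ha' : a ∈ B \ A := by simp [ha]
    refine ⟨a, (Finset.mem_sdiff.1 ha').1, ?_⟩
    rw [← Finset.sdiff_singleton_eq_erase, ← ha, Finset.sdiff_sdiff_eq_self hA.1]
  · intro a _
    rfl

/-- The simplex is acyclic: a cocycle is the coboundary of its cone from any vertex `v`. -/
lemma exists_eq_delta_of_delta_eq_zero {n j : ℕ} (v : Fin n) (c : Finset (Fin n) → ZMod 2)
    (hc : ∀ B : Finset (Fin n), B.card = j + 2 → delta n (j + 1) c B = 0) :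
    ∃ f : Finset (Fin n) → ZMod 2, ∀ S : Finset (Fin n), S.card = j + 1 → c S = delta n j f S := by
  refine ⟨fun A => if v ∈ A then 0 else c (insert v A), fun S hS => ?_⟩
  rw [delta_eq_sum_erase _ hS]
  by_cases hv : v ∈ S
  · rw [Finset.sum_eq_single_of_mem v hv]
    · simp [Finset.insert_erase hv]
    · intro a _ hav
      simp [hv, Ne.symm hav]
  · have hB : (insert v S).card = j + 1 + 1 := by rw [Finset.card_insert_of_notMem hv, hS]
    have h := hc _ hB
    rw [delta_eq_sum_erase _ hB, Finset.sum_insert hv, Finset.erase_insert hv] at h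
    rw [CharTwo.add_eq_zero.1 h]
    refine Finset.sum_congr rfl fun a ha => ?_
    have hav : v ≠ a := fun h => hv (h ▸ ha)
    simp [hv, Finset.erase_insert_of_ne hav]

lemma cochainNorm_add_two_eq {m : ℕ} (d : Finset (Fin (m + 3)) → ZMod 2) :
    cochainNorm (m + 3) (m + 1) d =
      (Finset.univ.filter fun v : Fin (m + 3) => d {v}ᶜ ≠ 0).card := by
  unfold cochainNorm
  symm
  refine Finset.card_bij (fun v _ => {v}ᶜ) ?_ ?_ ?_
  · intro v hv
    rw [Finset.mem_filter] at hv
    simp [Finset.mem_powersetCard, Finset.card_compl, hv.2]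
  · intro v _ w _ h
    simpa using h
  · intro B hB
    rw [Finset.mem_filter, Finset.mem_powersetCard] at hB
    have h1 : Bᶜ.card = 1 := by
      rw [Finset.card_compl, hB.1.2, Fintype.card_fin]
      omega
    obtain ⟨v, hv⟩ := Finset.card_eq_one.1 h1
    have hv' : B = {v}ᶜ := by rw [← hv, compl_compl]
    exact ⟨v, by simpa [← hv'] using hB.2, hv'.symm⟩

lemma cochainNorm_eq_zero {n k : ℕ} {c : Finset (Fin n) → ZMod 2} :
    cochainNorm n k c = 0 ↔ ∀ S : Finset (Fin n), S.card = k + 1 → c S = 0 := by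
  simp [cochainNorm, Finset.filter_eq_empty_iff, Finset.mem_powersetCard]

lemma delta_add (n j : ℕ) (c d : Finset (Fin n) → ZMod 2) (B : Finset (Fin n)) :
    delta n j (c + d) B = delta n j c B + delta n j d B := by
  simp [delta, Finset.sum_add_distrib]

lemma delta_single {n j : ℕ} {A : Finset (Fin n)} (hA : A.card = j) (B : Finset (Fin n)) :
    delta n j (Pi.single A 1) B = if A ⊆ B then 1 else 0 := by
  simp [delta, Pi.single_apply, Finset.mem_powersetCard, hA]

lemma delta_single_compl_pair {m : ℕ} {u w : Fin (m + 3)} (huw : u ≠ w) (v : Fin (m + 3)) :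
    delta (m + 3) (m + 1) (Pi.single {u, w}ᶜ 1) {v}ᶜ = if v = u ∨ v = w then 1 else 0 := by
  rw [delta_single (by rw [Finset.card_compl, Finset.card_pair huw, Fintype.card_fin]; omega)]
  simp [or_iff_not_imp_left]

lemma cochainNorm_single_le (n k : ℕ) (A : Finset (Fin n)) :
    cochainNorm n k (Pi.single A 1) ≤ 1 := by
  unfold cochainNorm
  rw [Finset.card_le_one]
  simp only [Finset.mem_filter, Pi.single_apply]
  aesop

lemma cochainNorm_add_le (n k : ℕ) (c d : Finset (Fin n) → ZMod 2) :
    cochainNorm n k (c + d) ≤ cochainNorm n k c + cochainNorm n k d := by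
  unfold cochainNorm
  refine (Finset.card_le_card ?_).trans (Finset.card_union_le _ _)
  intro s hs
  simp only [Finset.mem_union, Finset.mem_filter, Pi.add_apply] at hs ⊢
  by_cases h : c s = 0
  · exact Or.inr ⟨hs.1, by simpa [h] using hs.2⟩
  · exact Or.inl ⟨hs.1, h⟩

/-- Coboundaries are cocycles. -/
lemma delta_delta_eq_zero {n j : ℕ} (f : Finset (Fin n) → ZMod 2) {B : Finset (Fin n)}
    (hB : B.card = j + 2) : delta n (j + 1) (delta n j f) B = 0 := by
  have h (a : Fin n) (ha : a ∈ B) :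
      delta n j f (B.erase a) = ∑ b ∈ B.erase a, f ((B.erase a).erase b) :=
    delta_eq_sum_erase _ (by rw [Finset.card_erase_of_mem ha, hB]; rfl)
  rw [delta_eq_sum_erase _ hB, Finset.sum_congr rfl h, Finset.sum_sigma']
  refine Finset.sum_involution (fun p _ => ⟨p.2, p.1⟩) ?_ ?_ ?_ ?_
  · rintro ⟨a, b⟩ _
    simp only [Finset.erase_right_comm (a := b) (b := a)]
    exact CharTwo.add_self_eq_zero _
  · rintro ⟨a, b⟩ hp _ heq
    simp_all
  · rintro ⟨a, b⟩ hp
    simp only [Finset.mem_sigma, Finset.mem_erase] at hp ⊢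
    exact ⟨hp.2.2, hp.2.1.symm, hp.1⟩
  · rintro ⟨a, b⟩ _
    rfl

lemma sum_delta_compl_singleton {m : ℕ} (c : Finset (Fin (m + 3)) → ZMod 2) :
    ∑ v, delta (m + 3) (m + 1) c {v}ᶜ = 0 := by
  have hcard : (Finset.univ : Finset (Fin (m + 3))).card = m + 1 + 2 := by simp
  rw [← delta_delta_eq_zero c hcard, delta_eq_sum_erase _ hcard]
  simp_rw [Finset.compl_eq_univ_sdiff, Finset.sdiff_singleton_eq_erase]

lemma exists_two_mul_cochainNorm_add_delta_le {m : ℕ} (c : Finset (Fin (m + 3)) → ZMod 2) :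
    ∃ f, 2 * cochainNorm (m + 3) m (fun s => c s + delta (m + 3) m f s) ≤
      cochainNorm (m + 3) (m + 1) (delta (m + 3) (m + 1) c) := by
  induction hk : cochainNorm (m + 3) (m + 1) (delta (m + 3) (m + 1) c)
    using Nat.strong_induction_on generalizing c with
  | _ k ih =>
  subst hk
  rcases Nat.eq_zero_or_pos (cochainNorm (m + 3) (m + 1) (delta (m + 3) (m + 1) c)) with h0 | hpos
  · obtain ⟨f, hf⟩ := exists_eq_delta_of_delta_eq_zero 0 c (cochainNorm_eq_zero.1 h0)
    refine ⟨f, ?_⟩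
    have : cochainNorm (m + 3) m (fun s => c s + delta (m + 3) m f s) = 0 :=
      cochainNorm_eq_zero.2 fun S hS => CharTwo.add_eq_zero.2 (hf S hS)
    omega
  · rw [cochainNorm_add_two_eq] at hpos
    obtain ⟨u, hu⟩ := Finset.card_pos.1 hpos
    have hu' : delta (m + 3) (m + 1) c {u}ᶜ ≠ 0 := (Finset.mem_filter.1 hu).2
    obtain ⟨w, hwu, hw'⟩ : ∃ w, w ≠ u ∧ delta (m + 3) (m + 1) c {w}ᶜ ≠ 0 := by
      by_contra! h
      have hs := sum_delta_compl_singleton c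
      rw [Finset.sum_eq_single u (fun w _ hw => h w hw) (by simp)] at hs
      exact hu' hs
    have hone (x : ZMod 2) (hx : x ≠ 0) : x = 1 := by
      revert x
      decide
    have hcard : cochainNorm (m + 3) (m + 1)
        (delta (m + 3) (m + 1) (c + Pi.single {u, w}ᶜ 1)) + 2 =
          cochainNorm (m + 3) (m + 1) (delta (m + 3) (m + 1) c) := by
      have hsub : ({u, w} : Finset (Fin (m + 3))) ⊆
          Finset.univ.filter fun v => delta (m + 3) (m + 1) c {v}ᶜ ≠ 0 := by
        intro x hx
        rw [Finset.mem_insert, Finset.mem_singleton] at hx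
        rcases hx with rfl | rfl <;> simp [hu', hw']
      rw [cochainNorm_add_two_eq, cochainNorm_add_two_eq,
        ← Finset.card_sdiff_add_card_eq_card hsub, Finset.card_pair hwu.symm]
      congr 2
      ext x
      simp only [Finset.mem_filter, Finset.mem_univ, true_and, Finset.mem_sdiff,
        Finset.mem_insert, Finset.mem_singleton, delta_add, delta_single_compl_pair hwu.symm]
      by_cases hx : x = u ∨ x = w
      · have : delta (m + 3) (m + 1) c {x}ᶜ = 1 := by
          rcases hx with rfl | rfl
          · exact hone _ hu'
          · exact hone _ hw'
        simp [hx, this, CharTwo.add_self_eq_zero]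
      · simp [hx]
    have he := cochainNorm_single_le (m + 3) m {u, w}ᶜ
    obtain ⟨f, hf⟩ := ih _ (by omega) (c + Pi.single {u, w}ᶜ 1) rfl
    generalize (Pi.single {u, w}ᶜ 1 : Finset (Fin (m + 3)) → ZMod 2) = e at he hf hcard
    refine ⟨f, ?_⟩
    have hle := cochainNorm_add_le (m + 3) m (fun s => (c + e) s + delta (m + 3) m f s) e
    have heq : (fun s => (c + e) s + delta (m + 3) m f s) + e =
        fun s => c s + delta (m + 3) m f s := by
      funext s
      simp only [Pi.add_apply]
      linear_combination CharTwo.add_self_eq_zero (e s)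
    rw [heq] at hle
    omega

lemma cosysNormK_le (n k : ℕ) (c f : Finset (Fin n) → ZMod 2) :
    cosysNormK n k c ≤ cochainNorm n k (fun s => c s + delta n k f s) :=
  Nat.sInf_le ⟨f, rfl⟩

lemma cosysNormK_pos {n k : ℕ} {c : Finset (Fin n) → ZMod 2}
    (hc : ¬ ∃ f : Finset (Fin n) → ZMod 2,
      ∀ s : Finset (Fin n), s.card = k + 1 → c s = delta n k f s) :
    0 < cosysNormK n k c := by
  obtain ⟨f, hf⟩ := Nat.sInf_mem (s := {m | ∃ f : Finset (Fin n) → ZMod 2,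
    m = cochainNorm n k (fun s => c s + delta n k f s)}) ⟨_, 0, rfl⟩
  refine Nat.pos_of_ne_zero fun h0 => hc ⟨f, fun s hs => ?_⟩
  exact CharTwo.add_eq_zero.1 (cochainNorm_eq_zero.1 (hf.symm.trans h0) s hs)

lemma two_mul_cosysNormK_le {m : ℕ} (c : Finset (Fin (m + 3)) → ZMod 2) :
    2 * cosysNormK (m + 3) m c ≤ cochainNorm (m + 3) (m + 1) (delta (m + 3) (m + 1) c) := by
  obtain ⟨f, hf⟩ := exists_two_mul_cochainNorm_add_delta_le c
  have := cosysNormK_le (m + 3) m c f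
  omega

lemma cochainNorm_delta_single {m : ℕ} {u w : Fin (m + 3)} (huw : u ≠ w) :
    cochainNorm (m + 3) (m + 1) (delta (m + 3) (m + 1) (Pi.single {u, w}ᶜ 1)) = 2 := by
  rw [cochainNorm_add_two_eq]
  refine (congrArg Finset.card ?_).trans (Finset.card_pair huw)
  ext x
  simp only [delta_single_compl_pair huw]
  simp [or_iff_not_imp_left]

lemma delta_congr {n j : ℕ} {c d : Finset (Fin n) → ZMod 2}
    (h : ∀ S : Finset (Fin n), S.card = j → c S = d S) (B : Finset (Fin n)) :
    delta n j c B = delta n j d B :=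
  Finset.sum_congr rfl fun S hS => h S (Finset.mem_powersetCard.1 hS).2

lemma single_compl_pair_ne_delta {m : ℕ} {u w : Fin (m + 3)} (huw : u ≠ w) :
    ¬ ∃ f : Finset (Fin (m + 3)) → ZMod 2, ∀ s : Finset (Fin (m + 3)), s.card = m + 1 →
      (Pi.single {u, w}ᶜ 1 : Finset (Fin (m + 3)) → ZMod 2) s = delta (m + 3) m f s := by
  rintro ⟨f, hf⟩
  have h := delta_single_compl_pair huw u
  rw [delta_congr hf, delta_delta_eq_zero f (by simp [Finset.card_compl])] at h
  simp at h

/-- for `n ≥ 3`, the minimum of `‖δc‖/‖c‖_csy` over `(n-3)`-cochains `c`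
of the simplex on `n` vertices (with `ℤ/2` coefficients) which are not coboundaries
equals `2`. -/
theorem stmt_13 (n : ℕ) (hn : 3 ≤ n) :
    IsLeast {r : ℚ | ∃ c : Finset (Fin n) → ZMod 2,
        (¬ ∃ f : Finset (Fin n) → ZMod 2,
            ∀ s : Finset (Fin n), s.card = n - 2 → c s = delta n (n - 3) f s) ∧
        r = (cochainNorm n (n - 2) (delta n (n - 2) c) : ℚ) /
            (cosysNormK n (n - 3) c : ℚ)} 2 := by
  obtain ⟨m, rfl⟩ : ∃ m, n = m + 3 := ⟨n - 3, by omega⟩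
  change IsLeast {r : ℚ | ∃ c : Finset (Fin (m + 3)) → ZMod 2,
    (¬ ∃ f : Finset (Fin (m + 3)) → ZMod 2,
      ∀ s : Finset (Fin (m + 3)), s.card = m + 1 → c s = delta (m + 3) m f s) ∧
    r = (cochainNorm (m + 3) (m + 1) (delta (m + 3) (m + 1) c) : ℚ) /
      (cosysNormK (m + 3) m c : ℚ)} 2
  constructor
  · have h01 : (0 : Fin (m + 3)) ≠ 1 := by simp
    have hpos := cosysNormK_pos (single_compl_pair_ne_delta h01)
    have hle := two_mul_cosysNormK_le (Pi.single ({0, 1} : Finset (Fin (m + 3)))ᶜ 1)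
    refine ⟨_, single_compl_pair_ne_delta h01, ?_⟩
    rw [cochainNorm_delta_single h01] at hle ⊢
    have h1 : cosysNormK (m + 3) m (Pi.single ({0, 1} : Finset (Fin (m + 3)))ᶜ 1) = 1 := by
      omega
    rw [h1]
    norm_num
  · rintro r ⟨c, hc, rfl⟩
    rw [le_div_iff₀ (by exact_mod_cast cosysNormK_pos hc)]
    exact_mod_cast two_mul_cosysNormK_le c
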